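/- Let H be a numerical semigroup of genus g. Then H is symmetric, i.e. 2g−1 belongs to the gap set of H, if and only if the Young diagram Λ of H is self-conjugate, i.e. (with the convention Λ_j := 0 for j > g) Λ_i = #{ j ∈ {1,…,g} : Λ_j ≥ i } for every integer i ≥ 1. -/

import Mathlib

/-- If `2g - 1` is a gap of a numerical semigroup whose gap set `G` has `g` elements, then all gaps
are below `2g` and `n ↦ 2g - 1 - n` exchanges gaps and non-gaps. -/
lemma gap_reflection {H : AddSubmonoid ℕ} {G : Finset ℕ} (hG : ∀ n, n ∈ G ↔ n ∉ H)
    (hsymm : 2 * G.card - 1 ∉ H) :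
    (∀ n ∈ G, n < 2 * G.card) ∧ ∀ n < 2 * G.card, n ∈ H ↔ 2 * G.card - 1 - n ∉ H := by
  classical
  set g := G.card with hg
  let A := (Finset.range (2 * g)).filter (· ∈ H)
  let B := (Finset.range (2 * g)).filter (· ∉ H)
  have hAB : A.card + B.card = 2 * g := by
    simpa [A, B] using Finset.card_filter_add_card_filter_not (s := Finset.range (2 * g)) (· ∈ H)
  have hBG : B ⊆ G := fun n hn => (hG n).2 (Finset.mem_filter.1 hn).2
  have hmaps : A.image (fun n => 2 * g - 1 - n) ⊆ B := by
    intro m hm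
    obtain ⟨n, hn, rfl⟩ := Finset.mem_image.1 hm
    obtain ⟨hn, hnH⟩ := Finset.mem_filter.1 hn
    rw [Finset.mem_range] at hn
    refine Finset.mem_filter.2 ⟨Finset.mem_range.2 (by omega), fun h => hsymm ?_⟩
    have := H.add_mem hnH h
    rwa [show n + (2 * g - 1 - n) = 2 * g - 1 by omega] at this
  have hcard : (A.image (fun n => 2 * g - 1 - n)).card = A.card := by
    refine Finset.card_image_of_injOn fun a ha b hb hab => ?_
    have ha := Finset.mem_range.1 (Finset.mem_filter.1 ha).1
    have hb := Finset.mem_range.1 (Finset.mem_filter.1 hb).1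
    omega
  have hle := Finset.card_le_card hmaps
  have hle' := Finset.card_le_card hBG
  have hBeq : B = G := Finset.eq_of_subset_of_card_le hBG (by omega)
  have hAeq : A.image (fun n => 2 * g - 1 - n) = B :=
    Finset.eq_of_subset_of_card_le hmaps (by omega)
  refine ⟨fun n hn => ?_, fun n hn => ⟨fun h => ?_, fun h => ?_⟩⟩
  · rw [← hBeq] at hn
    exact Finset.mem_range.1 (Finset.mem_filter.1 hn).1
  · have : 2 * g - 1 - n ∈ B := hmaps (Finset.mem_image_of_mem _
      (Finset.mem_filter.2 ⟨Finset.mem_range.2 hn, h⟩))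
    exact (Finset.mem_filter.1 this).2
  · have : 2 * g - 1 - n ∈ B := Finset.mem_filter.2 ⟨Finset.mem_range.2 (by omega), h⟩
    rw [← hAeq] at this
    obtain ⟨m, hm, hmn⟩ := Finset.mem_image.1 this
    obtain ⟨hm, hmH⟩ := Finset.mem_filter.1 hm
    rw [Finset.mem_range] at hm
    rwa [show n = m by omega]

/-- The number of elements of `H` below the `k`-th gap is `ℓ k - k`. -/
lemma card_filter_mem_range_gap {H : AddSubmonoid ℕ} [DecidablePred (· ∈ H)] {g : ℕ}
    {ℓ : Fin g → ℕ} (hmono : StrictMono ℓ)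
    (hrange : Set.range ℓ = {n : ℕ | n ∉ H}) (k : Fin g) :
    ((Finset.range (ℓ k)).filter (· ∈ H)).card = ℓ k - k := by
  have hgap : (Finset.range (ℓ k)).filter (· ∉ H) = (Finset.Iio k).image ℓ := by
    ext n
    simp only [Finset.mem_filter, Finset.mem_range, Finset.mem_image, Finset.mem_Iio]
    constructor
    · rintro ⟨hn, hnH⟩
      obtain ⟨m, rfl⟩ : n ∈ Set.range ℓ := by rw [hrange]; exact hnH
      exact ⟨m, hmono.lt_iff_lt.1 hn, rfl⟩
    · rintro ⟨m, hm, rfl⟩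
      exact ⟨hmono hm, hrange.subset (Set.mem_range_self m)⟩
  have hsum := Finset.card_filter_add_card_filter_not (s := Finset.range (ℓ k)) (· ∈ H)
  rw [hgap, Finset.card_image_of_injective _ hmono.injective, Fin.card_Iio,
    Finset.card_range] at hsum
  omega

/-- In the symmetric case `ℓ k - k` counts the gaps `ℓ m` with `ℓ m + ℓ k ≥ 2g`. -/
lemma gap_sub_eq_card {H : AddSubmonoid ℕ} {g : ℕ} {ℓ : Fin g → ℕ} (hmono : StrictMono ℓ)
    (hrange : Set.range ℓ = {n : ℕ | n ∉ H}) (hlt : ∀ m, ℓ m < 2 * g)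
    (hrefl : ∀ n < 2 * g, n ∈ H ↔ 2 * g - 1 - n ∉ H) (k : Fin g) :
    ℓ k - k = (Finset.univ.filter (fun m => 2 * g ≤ ℓ m + ℓ k)).card := by
  classical
  rw [← card_filter_mem_range_gap hmono hrange k]
  symm
  refine Finset.card_bij (fun m _ => 2 * g - 1 - ℓ m) ?_ ?_ ?_
  · intro m hm
    have hm := (Finset.mem_filter.1 hm).2
    have := hlt m
    refine Finset.mem_filter.2 ⟨Finset.mem_range.2 (by omega), ?_⟩
    rw [hrefl _ (by omega), show 2 * g - 1 - (2 * g - 1 - ℓ m) = ℓ m by omega]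
    exact hrange.subset (Set.mem_range_self m)
  · intro a _ b _ hab
    have := hlt a
    have := hlt b
    exact hmono.injective (by omega)
  · intro n hn
    obtain ⟨hn, hnH⟩ := Finset.mem_filter.1 hn
    rw [Finset.mem_range] at hn
    have := hlt k
    obtain ⟨m, hm⟩ : 2 * g - 1 - n ∈ Set.range ℓ := by
      rw [hrange]
      exact (hrefl n (by omega)).1 hnH
    exact ⟨m, Finset.mem_filter.2 ⟨Finset.mem_univ _, by omega⟩, by omega⟩

/-- An upward closed condition on `Fin g` holds for at least `i` indices iff it holds at `g - i`. -/
lemma le_card_filter_iff_of_monotone {g i : ℕ} (hi : 1 ≤ i) (hig : i ≤ g) {p : Fin g → Prop}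
    [DecidablePred p] (hp : Monotone p) :
    i ≤ (Finset.univ.filter p).card ↔ p ⟨g - i, by omega⟩ := by
  constructor
  · intro h
    by_contra hn
    have hsub : Finset.univ.filter p ⊆ Finset.Ioi ⟨g - i, by omega⟩ := by
      intro m hm
      rw [Finset.mem_Ioi]
      by_contra hle
      exact hn (hp (not_lt.1 hle) (Finset.mem_filter.1 hm).2)
    have := Finset.card_le_card hsub
    rw [Fin.card_Ioi] at this
    dsimp only at this
    omega
  · intro h
    have hsub : Finset.Ici ⟨g - i, by omega⟩ ⊆ Finset.univ.filter p := fun m hm =>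
      Finset.mem_filter.2 ⟨Finset.mem_univ _, hp (Finset.mem_Ici.1 hm) h⟩
    have := Finset.card_le_card hsub
    rw [Fin.card_Ici] at this
    dsimp only at this
    omega

/-- A numerical semigroup `H` of genus `g` (with gap set enumerated by the
strictly monotone `ℓ : Fin g → ℕ`) is symmetric, i.e. `2g−1` is a gap of `H`,
if and only if its Young diagram `Λ` (given by `Λ_i = ℓ_{g−i} − (g−i)` for
`1 ≤ i ≤ g` and `Λ_i = 0` otherwise) is self-conjugate:
`Λ_i = #{ j ∈ {1,…,g} : Λ_j ≥ i }` for every `i ≥ 1`. -/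
theorem stmt_4 (H : AddSubmonoid ℕ) (g : ℕ) (hg : 0 < g)
    (ℓ : Fin g → ℕ) (hmono : StrictMono ℓ)
    (hrange : Set.range ℓ = {n : ℕ | n ∉ H})
    (Λ : ℕ → ℕ)
    (hΛ : ∀ i : ℕ, Λ i =
      if h : 1 ≤ i ∧ i ≤ g then ℓ ⟨g - i, by omega⟩ - (g - i) else 0) :
    (2 * g - 1 ∉ H) ↔
      ∀ i : ℕ, 1 ≤ i →
        Λ i = ((Finset.Icc 1 g).filter (fun j => i ≤ Λ j)).card := by
  classical
  have hcount : ∀ i, ((Finset.Icc 1 g).filter (fun j => i ≤ Λ j)).card =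
      (Finset.univ.filter (fun m : Fin g => i ≤ ℓ m - m)).card := by
    intro i
    symm
    refine Finset.card_bij (fun m _ => g - m) ?_ ?_ ?_
    · intro m hm
      have hm := (Finset.mem_filter.1 hm).2
      refine Finset.mem_filter.2 ⟨Finset.mem_Icc.2 (by omega), ?_⟩
      rw [hΛ, dif_pos (by omega)]
      simpa only [show g - (g - (m : ℕ)) = m by omega] using hm
    · intro a _ b _ hab
      ext
      omega
    · intro j hj
      obtain ⟨hj, hij⟩ := Finset.mem_filter.1 hj
      rw [Finset.mem_Icc] at hj
      rw [hΛ, dif_pos hj] at hij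
      exact ⟨⟨g - j, by omega⟩, Finset.mem_filter.2 ⟨Finset.mem_univ _, hij⟩,
        by dsimp only; omega⟩
  simp only [hcount]
  constructor
  · intro hsymm
    have hcard : (Finset.univ.image ℓ).card = g := by
      rw [Finset.card_image_of_injective _ hmono.injective, Finset.card_univ, Fintype.card_fin]
    have hG : ∀ n, n ∈ Finset.univ.image ℓ ↔ n ∉ H := by
      intro n
      have : n ∈ Set.range ℓ ↔ n ∉ H := by rw [hrange]; rfl
      simpa using this
    obtain ⟨hlt, hrefl⟩ := gap_reflection hG (by rwa [hcard])
    rw [hcard] at hlt hrefl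
    have key := gap_sub_eq_card hmono hrange
      (fun m => hlt _ (Finset.mem_image_of_mem _ (Finset.mem_univ m))) hrefl
    intro i hi
    by_cases hig : i ≤ g
    · rw [hΛ, dif_pos ⟨hi, hig⟩]
      refine (key ⟨g - i, by omega⟩).trans (congrArg _ (Finset.filter_congr fun m _ => ?_))
      rw [key m, le_card_filter_iff_of_monotone hi hig, add_comm]
      intro a b hab h
      have := hmono.monotone hab
      exact h.trans (by omega)
    · rw [hΛ, dif_neg (by omega), eq_comm, Finset.card_eq_zero, Finset.filter_eq_empty_iff]
      intro m _ h
      rw [key m] at h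
      have := h.trans (Finset.card_le_univ _)
      rw [Fintype.card_fin] at this
      exact hig this
  · intro h
    have hpos : ∀ m : Fin g, 1 ≤ ℓ m - m := by
      intro m
      rw [← card_filter_mem_range_gap hmono hrange m, Nat.one_le_iff_ne_zero]
      refine Finset.card_ne_zero_of_mem (a := 0) (Finset.mem_filter.2 ⟨?_, H.zero_mem⟩)
      rw [Finset.mem_range, Nat.pos_iff_ne_zero]
      intro h0
      exact hrange.subset (Set.mem_range_self m) (h0 ▸ H.zero_mem)
    have h1 := h 1 le_rfl
    rw [hΛ, dif_pos ⟨le_rfl, hg⟩, Finset.filter_true_of_mem fun m _ => hpos m,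
      Finset.card_univ, Fintype.card_fin] at h1
    have hlast : 2 * g - 1 = ℓ ⟨g - 1, by omega⟩ := by omega
    rw [hlast]
    exact hrange.subset (Set.mem_range_self _)
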